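/- Let κ be a perfect kernel on X satisfying Frostman's maximum principle and the domination principle, let A ⊆ X satisfy cap_*(A) = ∞, cap_*(A) > 0, and E⁺(A) closed in (E⁺, d), and let f := −U^ζ where ζ ∈ E⁺ and ζ(X) ≤ 1. Then: (a) if ζ(X) < 1, no solution of the inner Gauss variational problem for (A, f) exists; (b) if ζ(X) = 1 and ζ is concentrated on A, then the solution exists and equals ζ. -/

import Mathlib

open MeasureTheory Topology Filter Set ENNReal

noncomputable section

namespace GaussVar

variable {X : Type*} [TopologicalSpace X] [MeasurableSpace X]

/-- A (positive) Radon measure: a regular Borel measure. -/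
def IsRadon (μ : Measure X) : Prop := μ.Regular

/-- The mutual energy `I(μ,ν) = ∬ κ(x,y) d(μ⊗ν)(x,y)`. -/
def mutualEnergy (κ : X → X → ℝ≥0∞) (μ ν : Measure X) : ℝ≥0∞ :=
  ∫⁻ p : X × X, κ p.1 p.2 ∂(μ.prod ν)

/-- The energy `I(μ) := I(μ,μ)`. -/
def energy (κ : X → X → ℝ≥0∞) (μ : Measure X) : ℝ≥0∞ := mutualEnergy κ μ μ

/-- Membership in the cone `E⁺` of Radon measures with finite energy. -/
def memEplus (κ : X → X → ℝ≥0∞) (μ : Measure X) : Prop :=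
  IsRadon μ ∧ energy κ μ < ⊤

/-- A kernel: symmetric and lower semicontinuous with values in `[0,∞]`. -/
def IsKernel (κ : X → X → ℝ≥0∞) : Prop :=
  (∀ x y, κ x y = κ y x) ∧ LowerSemicontinuous (fun p : X × X => κ p.1 p.2)

/-- The strong (energy) metric `d(μ,ν) := (I(μ)+I(ν)−2I(μ,ν))^{1/2}` on `E⁺`. -/
def strongDist (κ : X → X → ℝ≥0∞) (μ ν : Measure X) : ℝ :=
  Real.sqrt ((energy κ μ).toReal + (energy κ ν).toReal - 2 * (mutualEnergy κ μ ν).toReal)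

/-- The energy principle (strict positive definiteness). -/
def EnergyPrinciple (κ : X → X → ℝ≥0∞) : Prop :=
  ∀ μ ν : Measure X, memEplus κ μ → memEplus κ ν →
    2 * mutualEnergy κ μ ν ≤ energy κ μ + energy κ ν ∧
      (2 * mutualEnergy κ μ ν = energy κ μ + energy κ ν → μ = ν)

/-- Convergence of a sequence in the strong metric. -/
def StrongTendstoSeq (κ : X → X → ℝ≥0∞) (μ : ℕ → Measure X) (μ₀ : Measure X) : Prop :=
  Tendsto (fun n => strongDist κ (μ n) μ₀) atTop (𝓝 0)

/-- Vague convergence of a sequence of measures. -/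
def VagueTendstoSeq (μ : ℕ → Measure X) (μ₀ : Measure X) : Prop :=
  ∀ φ : X → ℝ, Continuous φ → HasCompactSupport φ →
    Tendsto (fun n => ∫ x, φ x ∂(μ n)) atTop (𝓝 (∫ x, φ x ∂μ₀))

/-- Cauchy sequence in the strong metric. -/
def StrongCauchySeq (κ : X → X → ℝ≥0∞) (μ : ℕ → Measure X) : Prop :=
  ∀ ε : ℝ, 0 < ε → ∃ N : ℕ, ∀ m ≥ N, ∀ n ≥ N, strongDist κ (μ m) (μ n) < ε

/-- A perfect kernel: satisfies the energy principle, `(E⁺,d)` is complete, and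
strong convergence implies vague convergence. -/
def IsPerfect (κ : X → X → ℝ≥0∞) : Prop :=
  EnergyPrinciple κ ∧
    (∀ μ : ℕ → Measure X, (∀ n, memEplus κ (μ n)) → StrongCauchySeq κ μ →
        ∃ μ₀ : Measure X, memEplus κ μ₀ ∧ StrongTendstoSeq κ μ μ₀) ∧
    (∀ (μ : ℕ → Measure X) (μ₀ : Measure X), (∀ n, memEplus κ (μ n)) → memEplus κ μ₀ →
        StrongTendstoSeq κ μ μ₀ → VagueTendstoSeq μ μ₀)

/-- `μ` is concentrated on `A`: the complement of `A` is locally `μ`-negligible. -/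
def Concentrated (μ : Measure X) (A : Set X) : Prop :=
  ∀ K : Set X, IsCompact K → μ (Aᶜ ∩ K) = 0

/-- Membership in `Ĕ⁺(A)`: finite-energy Radon measures concentrated on `A`
of unit total mass. -/
def memBreve (κ : X → X → ℝ≥0∞) (A : Set X) (μ : Measure X) : Prop :=
  memEplus κ μ ∧ Concentrated μ A ∧ μ Set.univ = 1

/-- `w(A) := inf { I(μ) : μ ∈ Ĕ⁺(A) }` (with `inf ∅ = ⊤`). -/
def wcap (κ : X → X → ℝ≥0∞) (A : Set X) : ℝ≥0∞ :=
  ⨅ (μ : Measure X) (_ : memBreve κ A μ), energy κ μ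

/-- The inner capacity `cap_*(A) := 1 / w(A)`. -/
def innerCap (κ : X → X → ℝ≥0∞) (A : Set X) : ℝ≥0∞ := (wcap κ A)⁻¹

/-- The outer capacity `cap^*(E) := inf { cap_*(D) : D open, E ⊆ D }`. -/
def outerCap (κ : X → X → ℝ≥0∞) (E : Set X) : ℝ≥0∞ :=
  ⨅ (D : Set X) (_ : IsOpen D ∧ E ⊆ D), innerCap κ D

/-- `P` holds nearly everywhere (n.e.) on `A`: the exceptional subset of `A`
has inner capacity zero. -/
def NearlyEverywhere (κ : X → X → ℝ≥0∞) (A : Set X) (P : X → Prop) : Prop :=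
  innerCap κ {x ∈ A | ¬ P x} = 0

/-- The potential `U^μ(x) := ∫ κ(x,y) dμ(y)`. -/
def potential (κ : X → X → ℝ≥0∞) (μ : Measure X) (x : X) : ℝ≥0∞ :=
  ∫⁻ y, κ x y ∂μ

/-- An external field: `f = ψ + U^{ϑ⁺} − U^{ϑ⁻}` where `ψ` is lower semicontinuous,
`(−∞,∞]`-valued, positive if `X` is noncompact, and `ϑ⁺, ϑ⁻ ∈ E⁺`. -/
def IsExternalField (κ : X → X → ℝ≥0∞) (f : X → EReal) : Prop :=
  ∃ (ψ : X → EReal) (ϑp ϑm : Measure X),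
    LowerSemicontinuous ψ ∧ (∀ x, ψ x ≠ ⊥) ∧ (¬ CompactSpace X → ∀ x, 0 ≤ ψ x) ∧
    memEplus κ ϑp ∧ memEplus κ ϑm ∧
    ∀ x, f x = ψ x + (potential κ ϑp x : EReal) - (potential κ ϑm x : EReal)

/-- `f` is `μ`-integrable (as an extended-real-valued function). -/
def FieldIntegrable (f : X → EReal) (μ : Measure X) : Prop :=
  Integrable (fun x => (f x).toReal) μ ∧ (∀ᵐ x ∂μ, f x ≠ ⊤ ∧ f x ≠ ⊥)

/-- `∫ f dμ` for an a.e.-finite integrable field. -/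
def fieldIntegral (f : X → EReal) (μ : Measure X) : ℝ := ∫ x, (f x).toReal ∂μ

/-- The Gauss functional `I_f(μ) := I(μ) + 2 ∫ f dμ`. -/
def gaussI (κ : X → X → ℝ≥0∞) (f : X → EReal) (μ : Measure X) : ℝ :=
  (energy κ μ).toReal + 2 * fieldIntegral f μ

/-- Membership in `Ĕ⁺_f(A)`. -/
def Admissible (κ : X → X → ℝ≥0∞) (A : Set X) (f : X → EReal) (μ : Measure X) : Prop :=
  memBreve κ A μ ∧ FieldIntegrable f μ

/-- `w_f(A) := inf { I_f(μ) : μ ∈ Ĕ⁺_f(A) }` (with `inf ∅ = ⊤`). -/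
def wf (κ : X → X → ℝ≥0∞) (A : Set X) (f : X → EReal) : EReal :=
  ⨅ (μ : Measure X) (_ : Admissible κ A f μ), ((gaussI κ f μ : ℝ) : EReal)

/-- `l` is a solution of the inner Gauss variational problem for `(A,f)`. -/
def IsSolution (κ : X → X → ℝ≥0∞) (A : Set X) (f : X → EReal) (l : Measure X) : Prop :=
  Admissible κ A f l ∧ ((gaussI κ f l : ℝ) : EReal) = wf κ A f

/-- The `f`-weighted potential `U_f^μ := U^μ + f`. -/
def wPotential (κ : X → X → ℝ≥0∞) (f : X → EReal) (μ : Measure X) (x : X) : EReal :=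
  (potential κ μ x : EReal) + f x

/-- `∫ U_f^μ dμ`, the weighted equilibrium constant of a solution. -/
def wConst (κ : X → X → ℝ≥0∞) (f : X → EReal) (μ : Measure X) : ℝ :=
  ∫ x, (wPotential κ f μ x).toReal ∂μ

/-- The cone `E⁺(A)` is closed in the strong metric. -/
def StrongClosedEplusOn (κ : X → X → ℝ≥0∞) (A : Set X) : Prop :=
  ∀ (μ : ℕ → Measure X) (μ₀ : Measure X),
    (∀ n, memEplus κ (μ n) ∧ Concentrated (μ n) A) →
    memEplus κ μ₀ → StrongTendstoSeq κ μ μ₀ → Concentrated μ₀ A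

/-- Frostman's (first) maximum principle. -/
def FrostmanMax (κ : X → X → ℝ≥0∞) : Prop :=
  ∀ μ : Measure X, memEplus κ μ →
    (∀ x : X, (∀ U : Set X, IsOpen U → x ∈ U → 0 < μ U) → potential κ μ x ≤ 1) →
    ∀ x : X, potential κ μ x ≤ 1

/-- The domination (second maximum) principle. -/
def DominationPrinciple (κ : X → X → ℝ≥0∞) : Prop :=
  ∀ μ ν : Measure X, memEplus κ μ → memEplus κ ν →
    (∀ᵐ x ∂μ, potential κ μ x ≤ potential κ ν x) →
    ∀ x : X, potential κ μ x ≤ potential κ ν x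

/-- `β` is the inner balayage of `ζ` onto `A`: `β ∈ E⁺(A)` and `U^β = U^ζ` n.e. on `A`. -/
def IsInnerBalayage (κ : X → X → ℝ≥0∞) (A : Set X) (ζ β : Measure X) : Prop :=
  memEplus κ β ∧ Concentrated β A ∧
    NearlyEverywhere κ A (fun x => potential κ β x = potential κ ζ x)

/-- `γ` is the inner capacitary measure of `A`: `γ ∈ E⁺(A)` and `U^γ = 1` n.e. on `A`. -/
def IsCapacitaryMeasure (κ : X → X → ℝ≥0∞) (A : Set X) (γ : Measure X) : Prop :=
  memEplus κ γ ∧ Concentrated γ A ∧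
    NearlyEverywhere κ A (fun x => potential κ γ x = 1)

/-- `A` is quasiclosed: approximable in outer capacity by closed sets. -/
def Quasiclosed (κ : X → X → ℝ≥0∞) (A : Set X) : Prop :=
  ∀ ε : ℝ≥0∞, 0 < ε → ∃ F : Set X, IsClosed F ∧ outerCap κ (symmDiff A F) < ε

/-- `A` is quasicompact: approximable in outer capacity by compact sets. -/
def Quasicompact (κ : X → X → ℝ≥0∞) (A : Set X) : Prop :=
  ∀ ε : ℝ≥0∞, 0 < ε → ∃ K : Set X, IsCompact K ∧ outerCap κ (symmDiff A K) < ε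


/-- If a constant lies strictly below a directed family of lower semicontinuous functions on a
compact set, then it lies strictly below one member of the family. -/
lemma exists_mem_forall_lt_of_isCompact {Y : Type*} [TopologicalSpace Y]
    {F : Set (Y → ℝ≥0∞)} (hne : F.Nonempty)
    (hdir : DirectedOn (· ≤ ·) F) (hlsc : ∀ φ ∈ F, LowerSemicontinuous φ) {K : Set Y}
    (hK : IsCompact K) {c : ℝ≥0∞} (hc : ∀ x ∈ K, ∃ φ ∈ F, c < φ x) :
    ∃ φ ∈ F, ∀ x ∈ K, c < φ x := by
  have : Nonempty F := hne.to_subtype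
  obtain ⟨φ, hφ⟩ := hK.elim_directed_cover (fun φ : F => {x | c < φ.1 x})
    (fun φ => (hlsc φ.1 φ.2).isOpen_preimage c)
    (fun x hx => by
      obtain ⟨φ, hφ, h⟩ := hc x hx
      exact mem_iUnion.2 ⟨⟨φ, hφ⟩, h⟩)
    (fun a b => by
      obtain ⟨d, hd, h1, h2⟩ := hdir a.1 a.2 b.1 b.2
      exact ⟨⟨d, hd⟩, fun x hx => lt_of_lt_of_le hx (h1 x), fun x hx => lt_of_lt_of_le hx (h2 x)⟩)
  exact ⟨φ.1, φ.2, fun x hx => hφ hx⟩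

section Directed

variable [T2Space X] [BorelSpace X]

/-- Monotone convergence along directed families of lower semicontinuous functions, for a finite
inner regular measure. -/
theorem lintegral_le_biSup_of_directedOn (μ : Measure X) [IsFiniteMeasure μ] [μ.InnerRegular]
    {F : Set (X → ℝ≥0∞)} (hne : F.Nonempty) (hdir : DirectedOn (· ≤ ·) F)
    (hlsc : ∀ φ ∈ F, LowerSemicontinuous φ) {h : X → ℝ≥0∞}
    (hh : ∀ x, ∀ c < h x, ∃ φ ∈ F, c < φ x) :
    ∫⁻ x, h x ∂μ ≤ ⨆ φ ∈ F, ∫⁻ x, φ x ∂μ := by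
  classical
  rw [lintegral_eq_nnreal]
  refine iSup₂_le fun s hs => ?_
  refine ENNReal.le_of_forall_lt_one_mul_le fun r hr => ?_
  lift r to NNReal using hr.ne_top
  set S : ℝ≥0∞ := ⨆ φ ∈ F, ∫⁻ x, φ x ∂μ
  set D : ℝ≥0∞ := ∑ c ∈ s.range, (r : ℝ≥0∞) * c
  have hD : D ≠ ⊤ := by
    simp only [D]
    exact ENNReal.sum_ne_top.2 fun c _ => ENNReal.mul_ne_top coe_ne_top coe_ne_top
  have key : ∀ ε : NNReal, 0 < ε →
      (r : ℝ≥0∞) * (s.map (fun a : NNReal => (a : ℝ≥0∞))).lintegral μ ≤ S + ε * D := by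
    intro ε hε
    have hK : ∀ c : NNReal, ∃ K ⊆ s ⁻¹' {c}, IsCompact K ∧ μ (s ⁻¹' {c}) < μ K + ε := fun c =>
      (s.measurableSet_preimage {c}).exists_isCompact_lt_add (measure_ne_top _ _)
        (by exact_mod_cast hε.ne')
    choose K hKs hKc hKμ using hK
    have hφ : ∀ c : NNReal, ∃ φ ∈ F, ∀ x ∈ K c, (r : ℝ≥0∞) * c ≤ φ x := by
      intro c
      rcases eq_or_ne c 0 with rfl | hc
      · obtain ⟨φ, hφ⟩ := hne
        exact ⟨φ, hφ, fun x _ => by simp⟩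
      · obtain ⟨φ, hφ, h1⟩ := exists_mem_forall_lt_of_isCompact hne hdir hlsc (hKc c)
          (c := (r : ℝ≥0∞) * c) (fun x hx => hh x _ (by
            refine lt_of_lt_of_le ?_ (hs x)
            have : s x = c := hKs c hx
            rw [this]
            calc (r : ℝ≥0∞) * c < 1 * c := by
                  exact_mod_cast mul_lt_mul_of_pos_right (by exact_mod_cast hr)
                    (pos_iff_ne_zero.2 hc)
              _ = c := one_mul _))
        exact ⟨φ, hφ, fun x hx => (h1 x hx).le⟩
    choose φ hφF hφK using hφ
    have hub : ∀ t : Finset NNReal, ∃ ψ ∈ F, ∀ c ∈ t, φ c ≤ ψ := by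
      intro t
      induction t using Finset.induction_on with
      | empty => exact ⟨_, hne.some_mem, by simp⟩
      | insert a t _ ih =>
        obtain ⟨ψ, hψ, h1⟩ := ih
        obtain ⟨χ, hχ, h2, h3⟩ := hdir _ (hφF a) _ hψ
        refine ⟨χ, hχ, fun c hc => ?_⟩
        rcases Finset.mem_insert.1 hc with rfl | hc
        · exact h2
        · exact (h1 c hc).trans h3
    obtain ⟨ψ, hψ, hψφ⟩ := hub s.range
    have hsum : ∑ c ∈ s.range, (r : ℝ≥0∞) * c * μ (K c) ≤ S := by
      refine le_trans ?_ (le_iSup₂ (f := fun φ (_ : φ ∈ F) => ∫⁻ x, φ x ∂μ) ψ hψ)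
      calc ∑ c ∈ s.range, (r : ℝ≥0∞) * c * μ (K c)
          ≤ ∑ c ∈ s.range, ∫⁻ x in K c, ψ x ∂μ := by
            refine Finset.sum_le_sum fun c hc => ?_
            rw [← setLIntegral_const]
            exact setLIntegral_mono' (hKc c).measurableSet
              fun x hx => (hφK c x hx).trans (hψφ c hc x)
        _ = ∫⁻ x in ⋃ c ∈ s.range, K c, ψ x ∂μ := by
            refine (lintegral_biUnion_finset ?_ (fun c _ => (hKc c).measurableSet) _).symm
            intro a _ b _ hab
            refine disjoint_left.2 fun x hxa hxb => hab ?_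
            rw [← (hKs a hxa : s x = a), ← (hKs b hxb : s x = b)]
        _ ≤ ∫⁻ x, ψ x ∂μ := setLIntegral_le_lintegral _ _
    rw [SimpleFunc.map_lintegral, Finset.mul_sum]
    calc ∑ c ∈ s.range, (r : ℝ≥0∞) * (c * μ (s ⁻¹' {c}))
        ≤ ∑ c ∈ s.range, ((r : ℝ≥0∞) * c * μ (K c) + ε * (r * c)) := by
          refine Finset.sum_le_sum fun c _ => ?_
          calc (r : ℝ≥0∞) * (c * μ (s ⁻¹' {c})) ≤ r * (c * (μ (K c) + ε)) := by
                gcongr; exact (hKμ c).le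
            _ = _ := by ring
      _ = ∑ c ∈ s.range, (r : ℝ≥0∞) * c * μ (K c) + ε * D := by
          rw [Finset.sum_add_distrib, Finset.mul_sum]
      _ ≤ S + ε * D := by gcongr
  lift D to NNReal using hD with D'
  refine ENNReal.le_of_forall_pos_le_add fun ε hε _ => ?_
  refine (key (ε / (D' + 1)) (by positivity)).trans ?_
  gcongr
  norm_cast
  rw [div_mul_eq_mul_div]
  refine div_le_of_le_mul₀ (by positivity) (by positivity) ?_
  gcongr
  simp

end Directed

section Minorants

/-- Minorants of a kernel that are measurable for the product `σ`-algebra, lower semicontinuous in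
the second variable, and lower semicontinuous in the first one uniformly in the second. -/
structure IsMinorant (κ : X → X → ℝ≥0∞) (g : X × X → ℝ≥0∞) : Prop where
  measurable : Measurable g
  le : ∀ x y, g (x, y) ≤ κ x y
  eventually_le : ∀ x, ∀ᶠ x' in 𝓝 x, ∀ y, g (x, y) ≤ g (x', y)
  lowerSemicontinuous : ∀ x, LowerSemicontinuous fun y => g (x, y)

variable {κ : X → X → ℝ≥0∞}

lemma IsMinorant.zero : IsMinorant κ 0 where
  measurable := measurable_const
  le _ _ := zero_le
  eventually_le _ := Eventually.of_forall fun _ _ => le_rfl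
  lowerSemicontinuous _ := lowerSemicontinuous_const

lemma IsMinorant.sup {g h : X × X → ℝ≥0∞} (hg : IsMinorant κ g) (hh : IsMinorant κ h) :
    IsMinorant κ (g ⊔ h) where
  measurable := hg.measurable.sup hh.measurable
  le x y := sup_le (hg.le x y) (hh.le x y)
  eventually_le x := by
    filter_upwards [hg.eventually_le x, hh.eventually_le x] with x' h1 h2 y
    exact sup_le_sup (h1 y) (h2 y)
  lowerSemicontinuous x := (hg.lowerSemicontinuous x).sup (hh.lowerSemicontinuous x)

lemma IsKernel.exists_isMinorant_lt [OpensMeasurableSpace X] (hκ : IsKernel κ) (x y : X)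
    {c : ℝ≥0∞} (hc : c < κ x y) : ∃ g, IsMinorant κ g ∧ c < g (x, y) := by
  obtain ⟨d, hcd, hd⟩ := exists_between hc
  have hnhds : {p : X × X | d < κ p.1 p.2} ∈ 𝓝 (x, y) := hκ.2 (x, y) d hd
  obtain ⟨U, V, hU, hxU, hV, hyV, hUV⟩ := mem_nhds_prod_iff'.1 hnhds
  have hg : ∀ a b, (U ×ˢ V).indicator (fun _ => d) (a, b) =
      U.indicator (fun _ => V.indicator (fun _ => d) b) a := by
    intro a b
    by_cases ha : a ∈ U <;> by_cases hb : b ∈ V <;> simp [ha, hb]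
  refine ⟨(U ×ˢ V).indicator fun _ => d, ⟨?_, fun a b => ?_, fun a => ?_, fun a => ?_⟩, ?_⟩
  · exact measurable_const.indicator (hU.measurableSet.prod hV.measurableSet)
  · exact indicator_apply_le' (fun hab => (hUV hab).le) fun _ => zero_le
  · simp only [hg]
    by_cases ha : a ∈ U
    · filter_upwards [hU.mem_nhds ha] with a' ha' b
      simp [ha, ha']
    · exact Eventually.of_forall fun a' b => by simp [ha]
  · simp only [hg]
    by_cases ha : a ∈ U
    · simpa [ha] using hV.lowerSemicontinuous_indicator zero_le
    · simpa [ha] using lowerSemicontinuous_const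
  · rwa [indicator_of_mem (show (x, y) ∈ U ×ˢ V from ⟨hxU, hyV⟩)]

lemma IsMinorant.lowerSemicontinuous_lintegral {g : X × X → ℝ≥0∞} (hg : IsMinorant κ g)
    (ν : Measure X) : LowerSemicontinuous fun x => ∫⁻ y, g (x, y) ∂ν := by
  intro x c hc
  filter_upwards [hg.eventually_le x] with x' hx'
  exact hc.trans_le (lintegral_mono hx')

variable [T2Space X] [BorelSpace X]

lemma potential_eq_iSup_isMinorant (hκ : IsKernel κ) (ν : Measure X) [IsFiniteMeasure ν]
    [ν.InnerRegular] (x : X) :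
    potential κ ν x = ⨆ (g) (_ : IsMinorant κ g), ∫⁻ y, g (x, y) ∂ν := by
  refine le_antisymm ?_ (iSup₂_le fun g hg => lintegral_mono (hg.le x))
  have := lintegral_le_biSup_of_directedOn ν
    (F := (fun (g : X × X → ℝ≥0∞) y => g (x, y)) '' {g | IsMinorant κ g}) (h := κ x)
    ⟨_, 0, IsMinorant.zero, rfl⟩ ?_ ?_ ?_
  · rwa [iSup_image] at this
  · rintro _ ⟨g, hg, rfl⟩ _ ⟨h, hh, rfl⟩
    exact ⟨_, ⟨g ⊔ h, hg.sup hh, rfl⟩, fun y => le_sup_left (a := g (x, y)),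
      fun y => le_sup_right (a := g (x, y))⟩
  · rintro _ ⟨g, hg, rfl⟩
    exact hg.lowerSemicontinuous x
  · intro y c hc
    obtain ⟨g, hg, h⟩ := hκ.exists_isMinorant_lt x y hc
    exact ⟨_, ⟨g, hg, rfl⟩, h⟩

lemma lowerSemicontinuous_potential (hκ : IsKernel κ) (ν : Measure X) [IsFiniteMeasure ν]
    [ν.InnerRegular] : LowerSemicontinuous (potential κ ν) := by
  have : potential κ ν = fun x => ⨆ (g) (_ : IsMinorant κ g), ∫⁻ y, g (x, y) ∂ν :=
    funext (potential_eq_iSup_isMinorant hκ ν)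
  rw [this]
  exact lowerSemicontinuous_biSup fun g hg => hg.lowerSemicontinuous_lintegral ν

lemma measurable_potential (hκ : IsKernel κ) (ν : Measure X) [IsFiniteMeasure ν]
    [ν.InnerRegular] : Measurable (potential κ ν) :=
  (lowerSemicontinuous_potential hκ ν).measurable

/-- Tonelli's theorem for a kernel, which need not be measurable for the product `σ`-algebra. -/
theorem mutualEnergy_eq_lintegral_potential (hκ : IsKernel κ) (μ ν : Measure X)
    [IsFiniteMeasure μ] [μ.InnerRegular] [IsFiniteMeasure ν] [ν.InnerRegular] :
    mutualEnergy κ μ ν = ∫⁻ x, potential κ ν x ∂μ := by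
  refine le_antisymm (lintegral_prod_le _) ?_
  have := lintegral_le_biSup_of_directedOn μ
    (F := (fun (g : X × X → ℝ≥0∞) x => ∫⁻ y, g (x, y) ∂ν) '' {g | IsMinorant κ g})
    (h := potential κ ν) ⟨_, 0, IsMinorant.zero, rfl⟩ ?_ ?_ ?_
  · rw [iSup_image] at this
    refine this.trans (iSup₂_le fun g hg => ?_)
    rw [← lintegral_prod _ hg.measurable.aemeasurable]
    exact lintegral_mono fun p => hg.le p.1 p.2
  · rintro _ ⟨g, hg, rfl⟩ _ ⟨h, hh, rfl⟩
    exact ⟨_, ⟨g ⊔ h, hg.sup hh, rfl⟩,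
      fun x => lintegral_mono fun y => le_sup_left (a := g (x, y)),
      fun x => lintegral_mono fun y => le_sup_right (a := g (x, y))⟩
  · rintro _ ⟨g, hg, rfl⟩
    exact hg.lowerSemicontinuous_lintegral ν
  · intro x c hc
    rw [potential_eq_iSup_isMinorant hκ] at hc
    simp only [lt_iSup_iff] at hc
    obtain ⟨g, hg, h⟩ := hc
    exact ⟨_, ⟨g, hg, rfl⟩, h⟩

end Minorants

section Bilinear

lemma mutualEnergy_comm {κ : X → X → ℝ≥0∞} (hκ : IsKernel κ) (μ ν : Measure X)
    [SFinite μ] [SFinite ν] :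
    mutualEnergy κ μ ν = mutualEnergy κ ν μ := by
  unfold mutualEnergy
  rw [← Measure.prod_swap (μ := ν),
    show (Prod.swap : X × X → X × X) = MeasurableEquiv.prodComm from rfl, lintegral_map_equiv]
  exact lintegral_congr fun p => hκ.1 _ _

variable {Y : Type*} [MeasurableSpace Y] {κ : Y → Y → ℝ≥0∞}

lemma mutualEnergy_add_left (μ₁ μ₂ ν : Measure Y) [SFinite μ₁] [SFinite μ₂] [SFinite ν] :
    mutualEnergy κ (μ₁ + μ₂) ν = mutualEnergy κ μ₁ ν + mutualEnergy κ μ₂ ν := by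
  unfold mutualEnergy
  rw [Measure.add_prod, lintegral_add_measure]

lemma mutualEnergy_smul_left (c : NNReal) (μ ν : Measure Y) [SFinite ν] :
    mutualEnergy κ (c • μ) ν = c * mutualEnergy κ μ ν := by
  unfold mutualEnergy
  rw [Measure.prod_smul_left, lintegral_smul_measure]
  rfl

lemma mutualEnergy_mono {μ₁ μ₂ ν₁ ν₂ : Measure Y} [SFinite μ₁] [SFinite μ₂] [SFinite ν₁]
    [SFinite ν₂] (hμ : μ₁ ≤ μ₂) (hν : ν₁ ≤ ν₂) :
    mutualEnergy κ μ₁ ν₁ ≤ mutualEnergy κ μ₂ ν₂ :=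
  lintegral_mono' (Measure.prod_mono hμ hν) le_rfl

end Bilinear

section FiniteEnergy

/-- Finite inner regular measures of finite energy. -/
structure IsFiniteEnergy (κ : X → X → ℝ≥0∞) (μ : Measure X) : Prop where
  isFiniteMeasure : IsFiniteMeasure μ
  innerRegular : μ.InnerRegular
  energy_lt_top : energy κ μ < ⊤

/-- The mutual energy as a real number. -/
def realMutualEnergy (κ : X → X → ℝ≥0∞) (μ ν : Measure X) : ℝ := (mutualEnergy κ μ ν).toReal

lemma nnreal_smul_apply {Y : Type*} [MeasurableSpace Y] (c : NNReal) (μ : Measure Y) (s : Set Y) :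
    (c • μ) s = c * μ s := rfl

lemma realMutualEnergy_nonneg {Y : Type*} [MeasurableSpace Y] {κ : Y → Y → ℝ≥0∞}
    {μ ν : Measure Y} : 0 ≤ realMutualEnergy κ μ ν := ENNReal.toReal_nonneg

lemma potential_smul {Y : Type*} [MeasurableSpace Y] {κ : Y → Y → ℝ≥0∞} {μ : Measure Y}
    (c : NNReal) (x : Y) : potential κ (c • μ) x = c * potential κ μ x :=
  lintegral_smul_measure _ _

variable {κ : X → X → ℝ≥0∞} {μ ν τ : Measure X}

lemma IsFiniteEnergy.restrict (hμ : IsFiniteEnergy κ μ) (s : Set X) :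
    IsFiniteEnergy κ (μ.restrict s) := by
  have := hμ.isFiniteMeasure
  have := hμ.innerRegular
  exact ⟨inferInstance, inferInstance, (mutualEnergy_mono Measure.restrict_le_self
    Measure.restrict_le_self).trans_lt hμ.energy_lt_top⟩

lemma mutualEnergy_lt_top (hE : EnergyPrinciple κ) (hμ : memEplus κ μ) (hν : memEplus κ ν) :
    mutualEnergy κ μ ν < ⊤ := by
  have h := ((hE μ ν hμ hν).1).trans_lt (ENNReal.add_lt_top.2 ⟨hμ.2, hν.2⟩)
  refine lt_of_le_of_lt ?_ h
  rw [two_mul]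
  exact le_self_add

lemma IsFiniteEnergy.smul (hκ : IsKernel κ) (hμ : IsFiniteEnergy κ μ) (c : NNReal) :
    IsFiniteEnergy κ (c • μ) := by
  have := hμ.isFiniteMeasure
  have := hμ.innerRegular
  refine ⟨inferInstance, inferInstance, ?_⟩
  rw [energy, mutualEnergy_smul_left, mutualEnergy_comm hκ, mutualEnergy_smul_left]
  exact ENNReal.mul_lt_top coe_lt_top (ENNReal.mul_lt_top coe_lt_top hμ.energy_lt_top)

lemma realMutualEnergy_comm (hκ : IsKernel κ) (hμ : IsFiniteEnergy κ μ)
    (hν : IsFiniteEnergy κ ν) : realMutualEnergy κ μ ν = realMutualEnergy κ ν μ := by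
  have := hμ.isFiniteMeasure
  have := hν.isFiniteMeasure
  rw [realMutualEnergy, mutualEnergy_comm hκ, realMutualEnergy]

lemma realMutualEnergy_smul_left (hν : IsFiniteEnergy κ ν) (c : NNReal) :
    realMutualEnergy κ (c • μ) ν = c * realMutualEnergy κ μ ν := by
  have := hν.isFiniteMeasure
  rw [realMutualEnergy, mutualEnergy_smul_left, ENNReal.toReal_mul]
  rfl

lemma two_mul_realMutualEnergy_le (hE : EnergyPrinciple κ) (hμ : memEplus κ μ)
    (hν : memEplus κ ν) :
    2 * realMutualEnergy κ μ ν ≤ realMutualEnergy κ μ μ + realMutualEnergy κ ν ν := by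
  have h := ENNReal.toReal_mono (ENNReal.add_lt_top.2 ⟨hμ.2, hν.2⟩).ne (hE μ ν hμ hν).1
  rw [ENNReal.toReal_mul, ENNReal.toReal_add hμ.2.ne hν.2.ne] at h
  exact h

lemma memEplus.isFiniteEnergy (hμ : GaussVar.memEplus κ μ) (h : μ univ < ⊤) :
    IsFiniteEnergy κ μ := by
  have : IsFiniteMeasure μ := ⟨h⟩
  have : μ.Regular := hμ.1
  exact ⟨⟨h⟩, inferInstance, hμ.2⟩

lemma memBreve.isFiniteEnergy {A : Set X} (hμ : memBreve κ A μ) : IsFiniteEnergy κ μ :=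
  memEplus.isFiniteEnergy hμ.1 (by rw [hμ.2.2]; exact one_lt_top)

lemma realMutualEnergy_smul_right (hκ : IsKernel κ) (hμ : IsFiniteEnergy κ μ)
    (hν : IsFiniteEnergy κ ν) (c : NNReal) :
    realMutualEnergy κ μ (c • ν) = c * realMutualEnergy κ μ ν := by
  rw [realMutualEnergy_comm hκ hμ (hν.smul hκ c), realMutualEnergy_smul_left hμ,
    realMutualEnergy_comm hκ hν hμ]

lemma eq_of_two_mul_realMutualEnergy_eq (hE : EnergyPrinciple κ) (hμ : memEplus κ μ)
    (hν : memEplus κ ν)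
    (h : 2 * realMutualEnergy κ μ ν = realMutualEnergy κ μ μ + realMutualEnergy κ ν ν) :
    μ = ν := by
  refine (hE μ ν hμ hν).2 ((ENNReal.toReal_eq_toReal_iff' (ENNReal.mul_ne_top ofNat_ne_top
    (mutualEnergy_lt_top hE hμ hν).ne) (ENNReal.add_lt_top.2 ⟨hμ.2, hν.2⟩).ne).1 ?_)
  rw [ENNReal.toReal_mul, ENNReal.toReal_add hμ.2.ne hν.2.ne]
  exact h

lemma energy_ne_zero (hE : EnergyPrinciple κ) (hμ : memEplus κ μ) (h0 : μ ≠ 0) :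
    energy κ μ ≠ 0 := by
  intro h
  have hz : memEplus κ (0 : Measure X) :=
    ⟨show (0 : Measure X).Regular from inferInstance, by simp [energy, mutualEnergy]⟩
  refine h0 ((hE μ 0 hμ hz).2 ?_)
  rw [h]
  simp [energy, mutualEnergy]

variable [T2Space X] [BorelSpace X]

lemma IsFiniteEnergy.memEplus (hμ : IsFiniteEnergy κ μ) : memEplus κ μ := by
  have := hμ.isFiniteMeasure
  have := hμ.innerRegular
  exact ⟨show μ.Regular from inferInstance, hμ.energy_lt_top⟩

lemma IsFiniteEnergy.add (hκ : IsKernel κ) (hE : EnergyPrinciple κ) (hμ : IsFiniteEnergy κ μ)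
    (hν : IsFiniteEnergy κ ν) : IsFiniteEnergy κ (μ + ν) := by
  have := hμ.isFiniteMeasure
  have := hμ.innerRegular
  have := hν.isFiniteMeasure
  have := hν.innerRegular
  refine ⟨inferInstance, inferInstance, ?_⟩
  rw [energy, mutualEnergy_add_left, mutualEnergy_comm hκ μ, mutualEnergy_comm hκ ν,
    mutualEnergy_add_left, mutualEnergy_add_left, mutualEnergy_comm hκ ν μ]
  have h := mutualEnergy_lt_top hE hμ.memEplus hν.memEplus
  exact ENNReal.add_lt_top.2 ⟨ENNReal.add_lt_top.2 ⟨hμ.energy_lt_top, h⟩,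
    ENNReal.add_lt_top.2 ⟨h, hν.energy_lt_top⟩⟩

lemma realMutualEnergy_add_left (hE : EnergyPrinciple κ) (hμ : IsFiniteEnergy κ μ)
    (hν : IsFiniteEnergy κ ν) (hτ : IsFiniteEnergy κ τ) :
    realMutualEnergy κ (μ + ν) τ = realMutualEnergy κ μ τ + realMutualEnergy κ ν τ := by
  have := hμ.isFiniteMeasure
  have := hν.isFiniteMeasure
  have := hτ.isFiniteMeasure
  rw [realMutualEnergy, mutualEnergy_add_left,
    ENNReal.toReal_add (mutualEnergy_lt_top hE hμ.memEplus hτ.memEplus).ne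
      (mutualEnergy_lt_top hE hν.memEplus hτ.memEplus).ne]
  rfl

lemma realMutualEnergy_add_right (hκ : IsKernel κ) (hE : EnergyPrinciple κ)
    (hμ : IsFiniteEnergy κ μ) (hν : IsFiniteEnergy κ ν) (hτ : IsFiniteEnergy κ τ) :
    realMutualEnergy κ τ (μ + ν) = realMutualEnergy κ τ μ + realMutualEnergy κ τ ν := by
  rw [realMutualEnergy_comm hκ hτ (hμ.add hκ hE hν), realMutualEnergy_add_left hE hμ hν hτ,
    realMutualEnergy_comm hκ hμ hτ, realMutualEnergy_comm hκ hν hτ]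

lemma realMutualEnergy_add_self (hκ : IsKernel κ) (hE : EnergyPrinciple κ)
    (hμ : IsFiniteEnergy κ μ) (hν : IsFiniteEnergy κ ν) :
    realMutualEnergy κ (μ + ν) (μ + ν) =
      realMutualEnergy κ μ μ + 2 * realMutualEnergy κ μ ν + realMutualEnergy κ ν ν := by
  rw [realMutualEnergy_add_left hE hμ hν (hμ.add hκ hE hν),
    realMutualEnergy_add_right hκ hE hμ hν hμ, realMutualEnergy_add_right hκ hE hμ hν hν,
    realMutualEnergy_comm hκ hν hμ]
  ring

/-- The energy of a linear combination of two measures. -/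
lemma realMutualEnergy_add_smul_self (hκ : IsKernel κ) (hE : EnergyPrinciple κ)
    (hμ : IsFiniteEnergy κ μ) (hν : IsFiniteEnergy κ ν) (a b : NNReal) :
    realMutualEnergy κ (a • μ + b • ν) (a • μ + b • ν) =
      a ^ 2 * realMutualEnergy κ μ μ + 2 * a * b * realMutualEnergy κ μ ν +
        b ^ 2 * realMutualEnergy κ ν ν := by
  rw [realMutualEnergy_add_self hκ hE (hμ.smul hκ a) (hν.smul hκ b),
    realMutualEnergy_smul_left (hμ.smul hκ a), realMutualEnergy_smul_right hκ hμ hμ,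
    realMutualEnergy_smul_left (hν.smul hκ b), realMutualEnergy_smul_right hκ hμ hν,
    realMutualEnergy_smul_left (hν.smul hκ b), realMutualEnergy_smul_right hκ hν hν]
  ring

/-- The Cauchy–Schwarz inequality for mutual energies. -/
theorem realMutualEnergy_sq_le (hκ : IsKernel κ) (hE : EnergyPrinciple κ)
    (hμ : IsFiniteEnergy κ μ) (hν : IsFiniteEnergy κ ν) :
    realMutualEnergy κ μ ν ^ 2 ≤ realMutualEnergy κ μ μ * realMutualEnergy κ ν ν := by
  have h : ∀ s : ℝ, 0 ≤ realMutualEnergy κ μ μ * (s * s) + (-2 * realMutualEnergy κ μ ν) * s +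
      realMutualEnergy κ ν ν := by
    intro s
    have h0 : 0 ≤ realMutualEnergy κ μ ν := realMutualEnergy_nonneg
    have h1 : 0 ≤ realMutualEnergy κ μ μ := realMutualEnergy_nonneg
    have h2 : 0 ≤ realMutualEnergy κ ν ν := realMutualEnergy_nonneg
    rcases le_total 0 s with hs | hs
    · lift s to NNReal using hs
      have := two_mul_realMutualEnergy_le hE (hμ.smul hκ s).memEplus hν.memEplus
      rw [realMutualEnergy_smul_left hν, realMutualEnergy_smul_left (hμ.smul hκ s),
        realMutualEnergy_smul_right hκ hμ hμ] at this
      linarith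
    · have h3 := mul_nonneg h1 (mul_self_nonneg s)
      have h4 := mul_nonneg h0 (neg_nonneg.2 hs)
      linarith
  have := discrim_le_zero h
  unfold discrim at this
  linarith

lemma sqrt_realMutualEnergy_le (hκ : IsKernel κ) (hE : EnergyPrinciple κ)
    (hμ : IsFiniteEnergy κ μ) (hν : IsFiniteEnergy κ ν) :
    √(realMutualEnergy κ ν ν) ≤ √(realMutualEnergy κ μ μ) + strongDist κ μ ν := by
  have h1 : 0 ≤ realMutualEnergy κ μ μ := realMutualEnergy_nonneg
  have h2 : 0 ≤ realMutualEnergy κ ν ν := realMutualEnergy_nonneg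
  have h3 : realMutualEnergy κ μ ν ≤ √(realMutualEnergy κ μ μ) * √(realMutualEnergy κ ν ν) := by
    rw [← Real.sqrt_mul h1]
    exact Real.le_sqrt_of_sq_le (realMutualEnergy_sq_le hκ hE hμ hν)
  rw [← sub_le_iff_le_add']
  refine Real.le_sqrt_of_sq_le ?_
  change _ ≤ realMutualEnergy κ μ μ + realMutualEnergy κ ν ν - 2 * realMutualEnergy κ μ ν
  nlinarith [Real.sq_sqrt h1, Real.sq_sqrt h2]

lemma IsFiniteEnergy.lintegral_potential (hκ : IsKernel κ) (hμ : IsFiniteEnergy κ μ)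
    (hν : IsFiniteEnergy κ ν) : ∫⁻ x, potential κ ν x ∂μ = mutualEnergy κ μ ν := by
  have := hμ.isFiniteMeasure
  have := hμ.innerRegular
  have := hν.isFiniteMeasure
  have := hν.innerRegular
  exact (mutualEnergy_eq_lintegral_potential hκ μ ν).symm

lemma IsFiniteEnergy.lowerSemicontinuous_potential (hκ : IsKernel κ)
    (hν : IsFiniteEnergy κ ν) : LowerSemicontinuous (potential κ ν) := by
  have := hν.isFiniteMeasure
  have := hν.innerRegular
  exact GaussVar.lowerSemicontinuous_potential hκ ν

lemma IsFiniteEnergy.measurable_potential (hκ : IsKernel κ) (hν : IsFiniteEnergy κ ν) :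
    Measurable (potential κ ν) :=
  (hν.lowerSemicontinuous_potential hκ).measurable

end FiniteEnergy

section Equilibrium

/-- Unit measures of finite energy carried by `K`. -/
structure IsUnitMeasureOn (κ : X → X → ℝ≥0∞) (K : Set X) (μ : Measure X) : Prop where
  isFiniteEnergy : IsFiniteEnergy κ μ
  measure_univ : μ univ = 1
  measure_compl : μ Kᶜ = 0

variable {κ : X → X → ℝ≥0∞} {μ ν : Measure X} {K : Set X}

lemma IsFiniteEnergy.isUnitMeasureOn_smul_restrict (hκ : IsKernel κ) (hμ : IsFiniteEnergy κ μ)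
    {C : Set X} (hC : MeasurableSet C) (hCK : C ⊆ K) (h0 : μ C ≠ 0) :
    IsUnitMeasureOn κ K ((μ C).toNNReal⁻¹ • μ.restrict C) := by
  have := hμ.isFiniteMeasure
  have h1 : ((μ C).toNNReal : ℝ≥0∞) = μ C := coe_toNNReal (measure_ne_top _ _)
  have h2 : (μ C).toNNReal ≠ 0 := fun h => h0 (by rw [← h1, h, coe_zero])
  refine ⟨(hμ.restrict C).smul hκ _, ?_, ?_⟩
  · rw [nnreal_smul_apply, Measure.restrict_apply_univ, coe_inv h2, h1]
    exact ENNReal.inv_mul_cancel h0 (measure_ne_top _ _)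
  · rw [nnreal_smul_apply, Measure.restrict_apply' hC,
      (disjoint_compl_left_iff_subset.2 hCK).inter_eq, measure_empty, mul_zero]

variable [T2Space X] [BorelSpace X]

lemma IsUnitMeasureOn.add_smul (hκ : IsKernel κ) (hE : EnergyPrinciple κ)
    (hμ : IsUnitMeasureOn κ K μ) (hν : IsUnitMeasureOn κ K ν) {a b : NNReal} (hab : a + b = 1) :
    IsUnitMeasureOn κ K (a • μ + b • ν) where
  isFiniteEnergy := (hμ.isFiniteEnergy.smul hκ a).add hκ hE (hν.isFiniteEnergy.smul hκ b)
  measure_univ := by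
    rw [Measure.add_apply, nnreal_smul_apply, nnreal_smul_apply,
      hμ.measure_univ, hν.measure_univ, mul_one, mul_one]
    exact_mod_cast hab
  measure_compl := by
    rw [Measure.add_apply, nnreal_smul_apply, nnreal_smul_apply,
      hμ.measure_compl, hν.measure_compl, mul_zero, mul_zero, add_zero]

/-- Vague limits of unit measures on a compact set are unit measures on this set. -/
lemma VagueTendstoSeq.measure_univ_and_compl [LocallyCompactSpace X] (hK : IsCompact K)
    {μ : ℕ → Measure X} {μ₀ : Measure X} (hμ : ∀ n, IsUnitMeasureOn κ K (μ n))
    (hμ₀ : IsRadon μ₀) (h : VagueTendstoSeq μ μ₀) : μ₀ univ = 1 ∧ μ₀ Kᶜ = 0 := by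
  have hreg : μ₀.Regular := hμ₀
  have hcongr : ∀ (φ : X → ℝ) (c : ℝ), (∀ x ∈ K, φ x = c) → ∀ n, ∫ x, φ x ∂(μ n) = c := by
    intro φ c hφ n
    have h1 : φ =ᵐ[μ n] fun _ => c := by
      filter_upwards [show ∀ᵐ x ∂(μ n), x ∈ K from (hμ n).measure_compl] with x hx using hφ x hx
    rw [integral_congr_ae h1, integral_const, measureReal_def, (hμ n).measure_univ]
    simp
  have hcompl : μ₀ Kᶜ = 0 := by
    rw [hK.isClosed.isOpen_compl.measure_eq_iSup_isCompact μ₀]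
    refine le_antisymm (iSup₂_le fun L hLK => iSup_le fun hL => ?_) zero_le
    obtain ⟨φ, h1, h0, hc, h01⟩ := exists_continuous_one_zero_of_isCompact hL hK.isClosed
      (disjoint_left.2 fun x hx => hLK hx)
    have hlim := h φ φ.continuous hc
    simp only [hcongr φ 0 (fun x hx => h0 hx)] at hlim
    have hint : ∫ x, φ x ∂μ₀ = 0 := tendsto_nhds_unique hlim tendsto_const_nhds
    have hae := (integral_eq_zero_iff_of_nonneg (fun x => (h01 x).1)
      (φ.continuous.integrable_of_hasCompactSupport hc)).1 hint
    refine le_of_eq (measure_mono_null (fun x hx => ?_) (ae_iff.1 hae))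
    have := h1 hx
    simp_all
  refine ⟨?_, hcompl⟩
  obtain ⟨φ, h1, -, hc, h01⟩ := exists_continuous_one_zero_of_isCompact hK isClosed_empty
    (disjoint_empty K)
  have hlim := h φ φ.continuous hc
  simp only [hcongr φ 1 (fun x hx => h1 hx)] at hlim
  have hint : ∫ x, φ x ∂μ₀ = 1 := tendsto_nhds_unique hlim tendsto_const_nhds
  have hae : φ =ᵐ[μ₀] K.indicator fun _ => (1 : ℝ) := by
    filter_upwards [show ∀ᵐ x ∂μ₀, x ∈ K from hcompl] with x hx
    rw [indicator_of_mem hx]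
    exact h1 hx
  rw [integral_congr_ae hae, integral_indicator_const _ hK.measurableSet, measureReal_def,
    smul_eq_mul, mul_one, ENNReal.toReal_eq_one_iff] at hint
  rw [← measure_add_measure_compl hK.measurableSet, hint, hcompl, add_zero]

/-- Existence of a unit measure of minimal energy on a compact set. -/
theorem exists_isUnitMeasureOn_forall_le [LocallyCompactSpace X] (hκ : IsKernel κ)
    (hperf : IsPerfect κ) (hK : IsCompact K) (hne : ∃ μ, IsUnitMeasureOn κ K μ) :
    ∃ m, IsUnitMeasureOn κ K m ∧
      ∀ μ, IsUnitMeasureOn κ K μ → realMutualEnergy κ m m ≤ realMutualEnergy κ μ μ := by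
  obtain ⟨hE, hcomplete, hvague⟩ := hperf
  have hbdd : BddBelow ((fun μ => realMutualEnergy κ μ μ) '' {μ | IsUnitMeasureOn κ K μ}) :=
    ⟨0, by rintro _ ⟨μ, -, rfl⟩; exact realMutualEnergy_nonneg⟩
  set w : ℝ := sInf ((fun μ => realMutualEnergy κ μ μ) '' {μ | IsUnitMeasureOn κ K μ}) with hw
  have hwle : ∀ μ, IsUnitMeasureOn κ K μ → w ≤ realMutualEnergy κ μ μ := fun μ hμ =>
    csInf_le hbdd ⟨μ, hμ, rfl⟩
  have hex : ∀ n : ℕ, ∃ μ, IsUnitMeasureOn κ K μ ∧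
      realMutualEnergy κ μ μ < w + 1 / ((n : ℝ) + 1) := by
    intro n
    obtain ⟨_, ⟨μ, hμ, rfl⟩, h⟩ := exists_lt_of_csInf_lt (Set.Nonempty.image _ hne)
      (lt_add_of_pos_right w (Nat.one_div_pos_of_nat (n := n)))
    exact ⟨μ, hμ, h⟩
  choose μ hμ hμw using hex
  have hzero := tendsto_one_div_add_atTop_nhds_zero_nat (𝕜 := ℝ)
  have hdist : ∀ m n, strongDist κ (μ m) (μ n) ≤
      √(2 * (1 / ((m : ℝ) + 1) + 1 / ((n : ℝ) + 1))) := by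
    intro m n
    have hmid := hwle _ ((hμ m).add_smul hκ hE (hμ n) (add_halves (1 : NNReal)))
    rw [realMutualEnergy_add_smul_self hκ hE (hμ m).isFiniteEnergy (hμ n).isFiniteEnergy] at hmid
    refine Real.sqrt_le_sqrt ?_
    change realMutualEnergy κ (μ m) (μ m) + realMutualEnergy κ (μ n) (μ n) -
      2 * realMutualEnergy κ (μ m) (μ n) ≤ _
    push_cast at hmid
    linarith [hμw m, hμw n]
  have hcauchy : StrongCauchySeq κ μ := by
    intro ε hε
    obtain ⟨N, hN⟩ := ((tendsto_order.1 hzero).2 (ε ^ 2 / 4) (by positivity)).exists_forall_of_atTop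
    refine ⟨N, fun m hm n hn => (hdist m n).trans_lt ((Real.sqrt_lt' hε).2 ?_)⟩
    linarith [hN m hm, hN n hn]
  obtain ⟨m, hm, hlim⟩ := hcomplete μ (fun n => (hμ n).isFiniteEnergy.memEplus) hcauchy
  obtain ⟨hm1, hmK⟩ := (hvague μ m (fun n => (hμ n).isFiniteEnergy.memEplus) hm
    hlim).measure_univ_and_compl hK hμ hm.1
  have hmfin : IsFiniteEnergy κ m := memEplus.isFiniteEnergy hm (by rw [hm1]; exact one_lt_top)
  refine ⟨m, ⟨hmfin, hm1, hmK⟩, fun ν hν => le_trans ?_ (hwle ν hν)⟩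
  have hw0 : 0 ≤ w := Real.sInf_nonneg (by rintro _ ⟨μ, -, rfl⟩; exact realMutualEnergy_nonneg)
  refine (Real.sqrt_le_sqrt_iff hw0).1 ?_
  have hlim' : Tendsto (fun n : ℕ => √(w + 1 / ((n : ℝ) + 1)) + strongDist κ (μ n) m) atTop
      (𝓝 (√(w + 0) + 0)) := (Real.continuous_sqrt.tendsto _ |>.comp (hzero.const_add w)).add hlim
  rw [add_zero, add_zero] at hlim'
  refine ge_of_tendsto' hlim' fun n => ?_
  refine (sqrt_realMutualEnergy_le hκ hE (hμ n).isFiniteEnergy hmfin).trans ?_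
  gcongr
  exact (hμw n).le


lemma nonneg_of_forall_mul_add_sq_mul_nonneg {b c : ℝ}
    (h : ∀ t : NNReal, 0 < t → t ≤ 1 → 0 ≤ t * b + t ^ 2 * c) : 0 ≤ b := by
  by_contra! hb
  have hc : 0 < 2 * (|c| + 1) := by positivity
  obtain ⟨t, ht⟩ : ∃ t : NNReal, (t : ℝ) = min 1 (-b / (2 * (|c| + 1))) :=
    ⟨⟨_, le_min zero_le_one (div_nonneg (by linarith) hc.le)⟩, rfl⟩
  have ht0 : (0 : ℝ) < t := by rw [ht]; exact lt_min one_pos (div_pos (by linarith) hc)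
  have ht1 : (t : ℝ) ≤ 1 := ht.trans_le (min_le_left _ _)
  have ht2 : (t : ℝ) * (2 * (|c| + 1)) ≤ -b :=
    (le_div_iff₀ hc).1 (ht.trans_le (min_le_right _ _))
  have h1 := h t (by exact_mod_cast ht0) (by exact_mod_cast ht1)
  have h2 : 0 ≤ b + t * c := by
    refine nonneg_of_mul_nonneg_right ?_ ht0
    linarith
  nlinarith [mul_le_mul_of_nonneg_left (le_abs_self c) ht0.le]

/-- The variational inequality satisfied by a unit measure of minimal energy. -/
lemma IsUnitMeasureOn.realMutualEnergy_le_of_minimal (hκ : IsKernel κ) (hE : EnergyPrinciple κ)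
    {m σ : Measure X} (hm : IsUnitMeasureOn κ K m)
    (hmin : ∀ μ, IsUnitMeasureOn κ K μ → realMutualEnergy κ m m ≤ realMutualEnergy κ μ μ)
    (hσ : IsUnitMeasureOn κ K σ) : realMutualEnergy κ m m ≤ realMutualEnergy κ m σ := by
  have : 0 ≤ 2 * (realMutualEnergy κ m σ - realMutualEnergy κ m m) := by
    refine nonneg_of_forall_mul_add_sq_mul_nonneg (c := realMutualEnergy κ m m -
      2 * realMutualEnergy κ m σ + realMutualEnergy κ σ σ) fun t _ ht1 => ?_
    have h := hmin _ (hm.add_smul hκ hE hσ (tsub_add_cancel_of_le ht1))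
    rw [realMutualEnergy_add_smul_self hκ hE hm.isFiniteEnergy hσ.isFiniteEnergy,
      NNReal.coe_sub ht1, NNReal.coe_one] at h
    linarith
  linarith

/-- The potential of a unit measure of minimal energy on `K` is bounded below by this energy almost
everywhere on `K` for any measure of finite energy. -/
lemma IsUnitMeasureOn.energy_le_potential_of_minimal (hκ : IsKernel κ) (hE : EnergyPrinciple κ)
    (hK : MeasurableSet K) {m l : Measure X} (hm : IsUnitMeasureOn κ K m)
    (hmin : ∀ μ, IsUnitMeasureOn κ K μ → realMutualEnergy κ m m ≤ realMutualEnergy κ μ μ)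
    (hl : IsFiniteEnergy κ l) : ∀ᵐ x ∂(l.restrict K), energy κ m ≤ potential κ m x := by
  have hUm := hm.isFiniteEnergy.measurable_potential hκ
  have := hl.isFiniteMeasure
  set C : Set X := K ∩ {x | potential κ m x < energy κ m} with hCdef
  have hC : MeasurableSet C := hK.inter (measurableSet_lt hUm measurable_const)
  suffices h0 : l C = 0 by
    rw [ae_restrict_iff' hK, ae_iff]
    refine measure_mono_null (fun x hx => ?_) h0
    simpa [C, not_le] using hx
  by_contra h0
  have hσ := hl.isUnitMeasureOn_smul_restrict hκ hC (inter_subset_left (s := K)) h0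
  have h1 := hm.realMutualEnergy_le_of_minimal hκ hE hmin hσ
  have hlt := mutualEnergy_lt_top hE (hl.restrict C).memEplus hm.isFiniteEnergy.memEplus
  have h2 : mutualEnergy κ (l.restrict C) m < energy κ m * l C := by
    rw [← (hl.restrict C).lintegral_potential hκ hm.isFiniteEnergy, ← setLIntegral_const]
    refine setLIntegral_strict_mono hC h0 measurable_const ?_ ?_
    · rw [(hl.restrict C).lintegral_potential hκ hm.isFiniteEnergy]
      exact hlt.ne
    · exact Eventually.of_forall fun x hx => hx.2
  rw [realMutualEnergy_smul_right hκ hm.isFiniteEnergy (hl.restrict C),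
    realMutualEnergy_comm hκ hm.isFiniteEnergy (hl.restrict C)] at h1
  have h3 := (ENNReal.toReal_lt_toReal hlt.ne (ENNReal.mul_ne_top
    hm.isFiniteEnergy.energy_lt_top.ne (measure_ne_top _ _))).2 h2
  rw [ENNReal.toReal_mul] at h3
  have hpos : 0 < (l C).toReal := ENNReal.toReal_pos h0 (measure_ne_top _ _)
  rw [NNReal.coe_inv, ENNReal.coe_toNNReal_eq_toReal, inv_mul_eq_div, le_div_iff₀ hpos] at h1
  exact absurd h3 (not_lt.2 h1)

/-- Under Frostman's maximum principle, a compact set carries a measure whose potential is at most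
`1` everywhere and at least `1` almost everywhere on the set. -/
theorem exists_potential_le_one [LocallyCompactSpace X] (hκ : IsKernel κ) (hperf : IsPerfect κ)
    (hfr : FrostmanMax κ) (hK : IsCompact K) {l : Measure X} (hl : IsFiniteEnergy κ l)
    (hlK : l K ≠ 0) :
    ∃ γ, IsFiniteEnergy κ γ ∧ (∀ x, potential κ γ x ≤ 1) ∧
      ∀ᵐ x ∂(l.restrict K), 1 ≤ potential κ γ x := by
  have hE := hperf.1
  obtain ⟨m, hm, hmin⟩ := exists_isUnitMeasureOn_forall_le hκ hperf hK
    ⟨_, hl.isUnitMeasureOn_smul_restrict hκ hK.measurableSet subset_rfl hlK⟩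
  have hmE := hm.isFiniteEnergy
  have hge : ∀ l : Measure X, IsFiniteEnergy κ l →
      ∀ᵐ x ∂(l.restrict K), energy κ m ≤ potential κ m x := fun l hl =>
    hm.energy_le_potential_of_minimal hκ hE hK.measurableSet hmin hl
  have hw0 : energy κ m ≠ 0 := energy_ne_zero hE hmE.memEplus fun h => by
    simpa [h] using hm.measure_univ
  have hwt : energy κ m ≠ ⊤ := hmE.energy_lt_top.ne
  have hmK : m.restrict K = m := Measure.restrict_eq_self_of_ae_mem hm.measure_compl
  have hae : (fun _ => energy κ m) =ᵐ[m] potential κ m := by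
    have hle := hge m hmE
    rw [hmK] at hle
    refine ae_eq_of_ae_le_of_lintegral_le hle ?_
      (hmE.measurable_potential hκ).aemeasurable ?_
    · rw [lintegral_const, hm.measure_univ, mul_one]
      exact hwt
    · rw [lintegral_const, hm.measure_univ, mul_one, hmE.lintegral_potential hκ hmE, energy]
  have hcoe : (((energy κ m).toNNReal⁻¹ : NNReal) : ℝ≥0∞) = (energy κ m)⁻¹ := by
    rw [ENNReal.coe_inv (by simp [ENNReal.toNNReal_eq_zero_iff, hw0, hwt]), coe_toNNReal hwt]
  have hγ := hmE.smul hκ (energy κ m).toNNReal⁻¹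
  refine ⟨_, hγ, hfr _ hγ.memEplus fun x hx => ?_, ?_⟩
  · rw [potential_smul, hcoe]
    by_contra! h
    have hlt : energy κ m < potential κ m x := by
      refine lt_of_not_ge fun hle => h.not_ge ?_
      exact (mul_le_mul_right hle _).trans (ENNReal.inv_mul_cancel hw0 hwt).le
    refine (hx {x | energy κ m < potential κ m x}
      ((hmE.lowerSemicontinuous_potential hκ).isOpen_preimage _) hlt).ne' ?_
    rw [nnreal_smul_apply, mul_eq_zero]
    exact Or.inr (measure_mono_null (fun y hy => (ne_of_lt hy : _)) (ae_iff.1 hae))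
  · filter_upwards [hge l hl] with x hx
    rw [potential_smul, hcoe, ← ENNReal.inv_mul_cancel hw0 hwt]
    gcongr

/-- The principle of positivity of mass. -/
theorem measure_univ_le_of_potential_le [LocallyCompactSpace X] (hκ : IsKernel κ)
    (hperf : IsPerfect κ) (hfr : FrostmanMax κ) (hμ : IsFiniteEnergy κ μ)
    (hν : IsFiniteEnergy κ ν) (h : ∀ x, potential κ μ x ≤ potential κ ν x) :
    μ univ ≤ ν univ := by
  have : μ.Regular := hμ.memEplus.1
  have := hμ.isFiniteMeasure
  have := hν.isFiniteMeasure
  rw [isOpen_univ.measure_eq_iSup_isCompact μ]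
  refine iSup₂_le fun K _ => iSup_le fun hK => ?_
  rcases eq_or_ne (μ K) 0 with h0 | h0
  · rw [h0]; exact zero_le
  obtain ⟨γ, hγ, hle, hge⟩ := exists_potential_le_one hκ hperf hfr hK hμ h0
  have := hγ.isFiniteMeasure
  calc μ K = ∫⁻ _ in K, 1 ∂μ := by simp
    _ ≤ ∫⁻ x in K, potential κ γ x ∂μ := lintegral_mono_ae hge
    _ ≤ ∫⁻ x, potential κ γ x ∂μ := setLIntegral_le_lintegral _ _
    _ = ∫⁻ x, potential κ μ x ∂γ := by
      rw [hμ.lintegral_potential hκ hγ, hγ.lintegral_potential hκ hμ, mutualEnergy_comm hκ]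
    _ ≤ ∫⁻ x, potential κ ν x ∂γ := lintegral_mono h
    _ = ∫⁻ x, potential κ γ x ∂ν := by
      rw [hν.lintegral_potential hκ hγ, hγ.lintegral_potential hκ hν, mutualEnergy_comm hκ]
    _ ≤ ∫⁻ _, 1 ∂ν := lintegral_mono hle
    _ = ν univ := by simp

end Equilibrium

section Gauss

lemma exists_memBreve_energy_lt {κ : X → X → ℝ≥0∞} {A : Set X} (hcap : innerCap κ A = ⊤) {ε : ℝ}
    (hε : 0 < ε) :
    ∃ ω, memBreve κ A ω ∧ realMutualEnergy κ ω ω < ε := by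
  have hw : wcap κ A < ENNReal.ofReal ε := by
    rw [ENNReal.inv_eq_top.1 hcap]
    exact ENNReal.ofReal_pos.2 hε
  simp only [wcap, iInf_lt_iff] at hw
  obtain ⟨ω, hω, h⟩ := hw
  exact ⟨ω, hω, (ENNReal.lt_ofReal_iff_toReal_lt hω.1.2.ne).1 h⟩

variable [T2Space X] [BorelSpace X] {κ : X → X → ℝ≥0∞} {A : Set X} {f : X → EReal}
  {ζ μ l : Measure X}

lemma ae_potential_lt_top (hκ : IsKernel κ) (hE : EnergyPrinciple κ) (hζ : IsFiniteEnergy κ ζ)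
    (hμ : IsFiniteEnergy κ μ) : ∀ᵐ x ∂μ, potential κ ζ x < ⊤ := by
  refine ae_lt_top (hζ.measurable_potential hκ) ?_
  rw [hμ.lintegral_potential hκ hζ]
  exact (mutualEnergy_lt_top hE hμ.memEplus hζ.memEplus).ne

lemma memBreve.admissible (hκ : IsKernel κ) (hE : EnergyPrinciple κ) (hζ : IsFiniteEnergy κ ζ)
    (hf : ∀ x, f x = -((potential κ ζ x : ℝ≥0∞) : EReal)) (hμ : memBreve κ A μ) :
    Admissible κ A f μ := by
  refine ⟨hμ, ?_, ?_⟩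
  · simp only [hf, EReal.toReal_neg_eq, EReal.toReal_coe_ennreal]
    refine (integrable_toReal_of_lintegral_ne_top
      (hζ.measurable_potential hκ).aemeasurable ?_).neg
    rw [hμ.isFiniteEnergy.lintegral_potential hκ hζ]
    exact (mutualEnergy_lt_top hE hμ.1 hζ.memEplus).ne
  · filter_upwards [ae_potential_lt_top hκ hE hζ hμ.isFiniteEnergy] with x hx
    rw [hf, Ne, Ne, EReal.neg_eq_top_iff, EReal.neg_eq_bot_iff, EReal.coe_ennreal_eq_top_iff]
    exact ⟨EReal.coe_ennreal_ne_bot _, hx.ne⟩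

lemma gaussI_eq (hκ : IsKernel κ) (hE : EnergyPrinciple κ) (hζ : IsFiniteEnergy κ ζ)
    (hf : ∀ x, f x = -((potential κ ζ x : ℝ≥0∞) : EReal)) (hμ : IsFiniteEnergy κ μ) :
    gaussI κ f μ = realMutualEnergy κ μ μ - 2 * realMutualEnergy κ μ ζ := by
  have : fieldIntegral f μ = -realMutualEnergy κ μ ζ := by
    simp only [fieldIntegral, hf, EReal.toReal_neg_eq, EReal.toReal_coe_ennreal]
    rw [integral_neg, integral_toReal (hζ.measurable_potential hκ).aemeasurable
      (ae_potential_lt_top hκ hE hζ hμ), hμ.lintegral_potential hκ hζ, realMutualEnergy]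
  rw [gaussI, this]
  change realMutualEnergy κ μ μ + 2 * -realMutualEnergy κ μ ζ = _
  ring

lemma IsSolution.le (hκ : IsKernel κ) (hE : EnergyPrinciple κ) (hζ : IsFiniteEnergy κ ζ)
    (hf : ∀ x, f x = -((potential κ ζ x : ℝ≥0∞) : EReal)) (hl : IsSolution κ A f l)
    (hμ : memBreve κ A μ) :
    realMutualEnergy κ l l - 2 * realMutualEnergy κ l ζ ≤
      realMutualEnergy κ μ μ - 2 * realMutualEnergy κ μ ζ := by
  rw [← gaussI_eq hκ hE hζ hf hl.1.1.isFiniteEnergy, ← gaussI_eq hκ hE hζ hf hμ.isFiniteEnergy,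
    ← EReal.coe_le_coe_iff, hl.2]
  exact iInf₂_le μ (hμ.admissible hκ hE hζ hf)

lemma Concentrated.mono {Y : Type*} [TopologicalSpace Y] [MeasurableSpace Y] {A : Set Y}
    {μ ν : Measure Y} (hν : Concentrated ν A) (h : μ ≤ ν) : Concentrated μ A :=
  fun K hK => le_antisymm ((h _).trans (hν K hK).le) zero_le

/-- If unit measures on `A` may have arbitrarily small energy, then the potential of a solution of
the Gauss problem with the field `-U^ζ` is at most `U^ζ` almost everywhere. -/
theorem IsSolution.ae_potential_le (hκ : IsKernel κ) (hE : EnergyPrinciple κ)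
    (hcap : innerCap κ A = ⊤) (hζ : IsFiniteEnergy κ ζ)
    (hf : ∀ x, f x = -((potential κ ζ x : ℝ≥0∞) : EReal)) (hl : IsSolution κ A f l) :
    ∀ᵐ x ∂l, potential κ l x ≤ potential κ ζ x := by
  have hlE := hl.1.1.isFiniteEnergy
  have := hlE.isFiniteMeasure
  set B : Set X := {x | potential κ ζ x < potential κ l x}
  have hB : MeasurableSet B :=
    measurableSet_lt (hζ.measurable_potential hκ) (hlE.measurable_potential hκ)
  suffices h0 : l B = 0 by
    rw [ae_iff]
    simpa only [not_le] using h0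
  by_contra h0
  have hρ := hlE.restrict Bᶜ
  have hτ := hlE.restrict B
  set ρ := l.restrict Bᶜ
  set τ := l.restrict B
  have hl_eq : l = ρ + τ := by rw [add_comm]; exact (Measure.restrict_add_restrict_compl hB).symm
  have hlt : realMutualEnergy κ τ ζ < realMutualEnergy κ τ l := by
    refine (ENNReal.toReal_lt_toReal (mutualEnergy_lt_top hE hτ.memEplus hζ.memEplus).ne
      (mutualEnergy_lt_top hE hτ.memEplus hlE.memEplus).ne).2 ?_
    rw [← hτ.lintegral_potential hκ hζ, ← hτ.lintegral_potential hκ hlE]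
    refine setLIntegral_strict_mono hB h0 (hlE.measurable_potential hκ) ?_
      (Eventually.of_forall fun x hx => hx)
    rw [hτ.lintegral_potential hκ hζ]
    exact (mutualEnergy_lt_top hE hτ.memEplus hζ.memEplus).ne
  obtain ⟨a, ha0, ha⟩ : ∃ a, 0 < a ∧ a = realMutualEnergy κ τ l - realMutualEnergy κ τ ζ :=
    ⟨_, sub_pos.2 hlt, rfl⟩
  set M : NNReal := (l B).toNNReal
  have hM : (M : ℝ≥0∞) = l B := coe_toNNReal (measure_ne_top _ _)
  have hpos : 0 < (M : ℝ) ^ 2 * realMutualEnergy κ l l + 1 := by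
    have : 0 ≤ realMutualEnergy κ l l := realMutualEnergy_nonneg
    positivity
  obtain ⟨ω, hω, hωlt⟩ := exists_memBreve_energy_lt hcap (div_pos (pow_pos ha0 2) hpos)
  have hωE := hω.isFiniteEnergy
  have hsmall : M * realMutualEnergy κ l ω < a := by
    refine lt_of_pow_lt_pow_left₀ 2 ha0.le ?_
    rw [lt_div_iff₀ hpos] at hωlt
    have h1 := mul_le_mul_of_nonneg_left (realMutualEnergy_sq_le hκ hE hlE hωE)
      (sq_nonneg (M : ℝ))
    have h2 : 0 ≤ realMutualEnergy κ ω ω := realMutualEnergy_nonneg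
    linarith
  have hcomp : ∀ t : NNReal, t ≤ 1 → memBreve κ A (ρ + ((1 - t) • τ + (t * M) • ω)) := by
    intro t ht
    refine ⟨(hρ.add hκ hE ((hτ.smul hκ _).add hκ hE (hωE.smul hκ _))).memEplus,
      fun K hK => ?_, ?_⟩
    · rw [Measure.add_apply, Measure.add_apply, nnreal_smul_apply, nnreal_smul_apply,
        hl.1.1.2.1.mono Measure.restrict_le_self K hK,
        hl.1.1.2.1.mono Measure.restrict_le_self K hK, hω.2.1 K hK]
      simp
    · have huniv : ρ univ + l B = 1 := by
        rw [← hl.1.1.2.2, Measure.restrict_apply_univ, add_comm, measure_add_measure_compl hB]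
      have hτu : τ univ = l B := Measure.restrict_apply_univ _
      rw [Measure.add_apply, Measure.add_apply, nnreal_smul_apply, nnreal_smul_apply, hτu, hω.2.2,
        mul_one, coe_mul, hM, ← add_mul, ← coe_add,
        tsub_add_cancel_of_le ht, coe_one, one_mul, huniv]
  have hb : 0 ≤ 2 * (M * realMutualEnergy κ l ω - realMutualEnergy κ τ l +
      realMutualEnergy κ τ ζ - M * realMutualEnergy κ ω ζ) := by
    refine nonneg_of_forall_mul_add_sq_mul_nonneg (c := realMutualEnergy κ τ τ -
      2 * M * realMutualEnergy κ τ ω + M ^ 2 * realMutualEnergy κ ω ω) fun t _ ht => ?_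
    have h := hl.le hκ hE hζ hf (hcomp t ht)
    have hτ' := hτ.smul hκ (1 - t)
    have hω' := hωE.smul hκ (t * M)
    rw [realMutualEnergy_add_self hκ hE hρ (hτ'.add hκ hE hω'),
      realMutualEnergy_add_smul_self hκ hE hτ hωE, realMutualEnergy_add_right hκ hE hτ' hω' hρ,
      realMutualEnergy_smul_right hκ hρ hτ, realMutualEnergy_smul_right hκ hρ hωE,
      realMutualEnergy_add_left hE hρ (hτ'.add hκ hE hω') hζ,
      realMutualEnergy_add_left hE hτ' hω' hζ, realMutualEnergy_smul_left hζ,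
      realMutualEnergy_smul_left hζ, NNReal.coe_sub ht, NNReal.coe_mul, NNReal.coe_one] at h
    have h1 : realMutualEnergy κ l l = realMutualEnergy κ ρ ρ + 2 * realMutualEnergy κ ρ τ +
        realMutualEnergy κ τ τ := by
      rw [← realMutualEnergy_add_self hκ hE hρ hτ, ← hl_eq]
    have h2 : realMutualEnergy κ l ζ = realMutualEnergy κ ρ ζ + realMutualEnergy κ τ ζ := by
      rw [← realMutualEnergy_add_left hE hρ hτ hζ, ← hl_eq]
    have h3 : realMutualEnergy κ l ω = realMutualEnergy κ ρ ω + realMutualEnergy κ τ ω := by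
      rw [← realMutualEnergy_add_left hE hρ hτ hωE, ← hl_eq]
    have h4 : realMutualEnergy κ τ l = realMutualEnergy κ ρ τ + realMutualEnergy κ τ τ := by
      rw [realMutualEnergy_comm hκ hρ hτ, ← realMutualEnergy_add_right hκ hE hρ hτ hτ, ← hl_eq]
    rw [h1, h2] at h
    rw [h3, h4]
    linarith
  have h5 : 0 ≤ M * realMutualEnergy κ ω ζ := mul_nonneg M.2 realMutualEnergy_nonneg
  linarith

end Gauss

theorem stmt10 {X : Type*} [TopologicalSpace X] [T2Space X] [LocallyCompactSpace X]
    [MeasurableSpace X] [BorelSpace X]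
    (κ : X → X → ℝ≥0∞) (A : Set X) (ζ : Measure X) (f : X → EReal)
    (hker : IsKernel κ) (hperf : IsPerfect κ)
    (hfr : FrostmanMax κ) (hdom : DominationPrinciple κ)
    (hcapinf : innerCap κ A = ⊤) (hcap0 : innerCap κ A ≠ 0)
    (hclosed : StrongClosedEplusOn κ A)
    (hζ : memEplus κ ζ) (hζ1 : ζ Set.univ ≤ 1)
    (hf : ∀ x, f x = -((potential κ ζ x : ℝ≥0∞) : EReal)) :
    -- (a) if `ζ(X) < 1` there is no solution
    (ζ Set.univ < 1 → ¬ ∃ l : Measure X, IsSolution κ A f l) ∧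
    -- (b) if `ζ(X) = 1` and `ζ` is concentrated on `A`, the solution exists and is `ζ`
    (ζ Set.univ = 1 → Concentrated ζ A →
      IsSolution κ A f ζ ∧ ∀ l : Measure X, IsSolution κ A f l → l = ζ) := by
  have hE := hperf.1
  have hζE : IsFiniteEnergy κ ζ := hζ.isFiniteEnergy (hζ1.trans_lt one_lt_top)
  refine ⟨fun hlt ⟨l, hl⟩ => ?_, fun h1 hA => ?_⟩
  · have hlE := hl.1.1.isFiniteEnergy
    have hle := measure_univ_le_of_potential_le hker hperf hfr hlE hζE
      (hdom l ζ hlE.memEplus hζ (hl.ae_potential_le hker hE hcapinf hζE hf))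
    rw [hl.1.1.2.2] at hle
    exact hle.not_gt hlt
  · have hB : memBreve κ A ζ := ⟨hζ, hA, h1⟩
    refine ⟨⟨hB.admissible hker hE hζE hf, le_antisymm (le_iInf₂ fun μ hμ => ?_)
      (iInf₂_le ζ (hB.admissible hker hE hζE hf))⟩, fun l hl => ?_⟩
    · have hμE := hμ.1.isFiniteEnergy
      rw [EReal.coe_le_coe_iff, gaussI_eq hker hE hζE hf hζE, gaussI_eq hker hE hζE hf hμE]
      linarith [two_mul_realMutualEnergy_le hE hμE.memEplus hζ]
    · have hlE := hl.1.1.isFiniteEnergy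
      refine eq_of_two_mul_realMutualEnergy_eq hE hlE.memEplus hζ ?_
      linarith [two_mul_realMutualEnergy_le hE hlE.memEplus hζ, hl.le hker hE hζE hf hB]

end GaussVar
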